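/- Let (X_i, Y_i, Z_i), i = 1,…,n with n ≥ 2, be i.i.d. random triples with values in 𝒳 × 𝒴 × 𝒵, where 𝒳 is a measurable space equipped with a σ-finite measure ν₀ and a measurable linear order. Assume the null hypothesis H₀: X_i is conditionally independent of Y_i given Z_i, and that the conditional distribution of X_i given Z_i = z has density q(·|z) with respect to ν₀ with q(x|z) > 0 for all x, z. Assume almost surely the values X_1,…,X_n are pairwise distinct; let X_{()} denote their order statistics and Π ∈ S_n the permutation with X = X_{(Π)}. Conditional on (X, Y, Z), let Π_♯ be obtained by running S ≥ 1 steps of the parallelized pairwise sampler kernel K (with weights w(π) = Π_{i=1}^n q(X_{(π(i))}|Z_i)) started from Π, and conditional on Π_♯ let Π^(1),…,Π^(M) be obtained by M independent runs of S steps of K started from Π_♯; set X^(m) = X_{(Π^(m))}. Then the M+1 triples (X, Y, Z), (X^(1), Y, Z), …, (X^(M), Y, Z) are exchangeable. -/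

import Mathlib

open MeasureTheory
open scoped ENNReal NNReal Classical

instance (n : ℕ) : MeasurableSpace (Equiv.Perm (Fin n)) := ⊤

/-- A partition of `{1,…,n}` into `⌊n/2⌋` disjoint pairs (with one index left unpaired when
`n` is odd), encoded as an involutive permutation whose number of fixed points is `n % 2`. -/
def IsPairing {n : ℕ} (σ : Equiv.Perm (Fin n)) : Prop :=
  σ * σ = 1 ∧ (Finset.univ.filter fun i => σ i = i).card = n % 2

/-- The set `𝒫` of all partitions of `{1,…,n}` into `⌊n/2⌋` disjoint pairs. -/
noncomputable def pairings (n : ℕ) : Finset (Equiv.Perm (Fin n)) :=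
  Finset.univ.filter IsPairing

/-- `swapRel p π π'` : `π'` is obtained from `π` by composing on the right with the product
of the transpositions of a subset of the pairs of the pairing `p`. -/
def swapRel {n : ℕ} (p : Equiv.Perm (Fin n)) (π π' : Equiv.Perm (Fin n)) : Prop :=
  ∃ τ : Equiv.Perm (Fin n), (∀ i, τ i = i ∨ τ i = p i) ∧ π' = π * τ

/-- The one-step transition kernel of the parallelized pairwise sampler (Algorithm 1):
`K(π,π') = (1/|𝒫|) Σ_{p ∈ 𝒫} 1{π' ~_p π} · w(π') / Σ_{π'' ~_p π} w(π'')`. -/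
noncomputable def pairwiseKernel {n : ℕ} (w : Equiv.Perm (Fin n) → ℝ≥0∞)
    (π π' : Equiv.Perm (Fin n)) : ℝ≥0∞ :=
  (∑ p ∈ pairings n,
      if swapRel p π π' then
        w π' / ∑ π'' ∈ Finset.univ.filter fun π'' => swapRel p π π'', w π''
      else 0)
    / ((pairings n).card : ℝ≥0∞)

/-- `S`-step transition probabilities of a kernel on a finite state space. -/
noncomputable def kernelPow {𝒮 : Type*} [Fintype 𝒮] [DecidableEq 𝒮]
    (K : 𝒮 → 𝒮 → ℝ≥0∞) : ℕ → 𝒮 → 𝒮 → ℝ≥0∞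
  | 0, a, b => if a = b then 1 else 0
  | (s + 1), a, b => ∑ c, K a c * kernelPow K s c b

/-- Order statistics of the `X`-coordinates of a data vector `d : Fin n → 𝒵 × 𝒳 × 𝒴`. -/
noncomputable def Xord {𝒳 𝒴 𝒵 : Type*} [LinearOrder 𝒳] {n : ℕ}
    (d : Fin n → 𝒵 × 𝒳 × 𝒴) : Fin n → 𝒳 :=
  (fun i => (d i).2.1) ∘ Tuple.sort fun i => (d i).2.1

/-- The rank permutation `Π` of a data vector, so that `X_i = Xord (Π i)`. -/
noncomputable def rankPerm {𝒳 𝒴 𝒵 : Type*} [LinearOrder 𝒳] {n : ℕ}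
    (d : Fin n → 𝒵 × 𝒳 × 𝒴) : Equiv.Perm (Fin n) :=
  (Tuple.sort fun i => (d i).2.1)⁻¹

/-- The CPT weight `w(π) = Π_{i=1}^n q(X_{(π(i))} | Z_i)` of a permutation, computed from the
order statistics of the data. -/
noncomputable def cptWeight {𝒳 𝒴 𝒵 : Type*} [LinearOrder 𝒳] {n : ℕ} (q : 𝒳 → 𝒵 → ℝ≥0)
    (d : Fin n → 𝒵 × 𝒳 × 𝒴) (π : Equiv.Perm (Fin n)) : ℝ≥0∞ :=
  ∏ i, (q (Xord d (π i)) ((d i).1) : ℝ≥0∞)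

/-- The law of `(Π⁽¹⁾,…,Π⁽ᴹ⁾)` given the data `d`: starting from the true ranks `Π`, run `S`
steps of the pairwise sampler to obtain `Π♯`, then run `M` independent chains of `S` steps
from `Π♯`. -/
noncomputable def cptSamplerLaw {𝒳 𝒴 𝒵 : Type*} [LinearOrder 𝒳] {n : ℕ} (q : 𝒳 → 𝒵 → ℝ≥0)
    (S M : ℕ) (d : Fin n → 𝒵 × 𝒳 × 𝒴) : Measure (Fin M → Equiv.Perm (Fin n)) :=
  ∑ v : Fin M → Equiv.Perm (Fin n),
    (∑ c : Equiv.Perm (Fin n),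
        kernelPow (pairwiseKernel (cptWeight q d)) S (rankPerm d) c
          * ∏ m : Fin M, kernelPow (pairwiseKernel (cptWeight q d)) S c (v m))
      • Measure.dirac v

section MeasureTools

/-- Tonelli's theorem for a product of functions of the separate coordinates. -/
theorem lintegral_pi_prod {E : Type*} [MeasurableSpace E] (μ : Measure E) [SigmaFinite μ]
    {n : ℕ} (f : Fin n → E → ℝ≥0∞) (hf : ∀ i, Measurable (f i)) :
    ∫⁻ x : Fin n → E, ∏ i, f i (x i) ∂(Measure.pi fun _ => μ) = ∏ i, ∫⁻ x, f i x ∂μ := by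
  induction n with
  | zero => simp
  | succ n ih =>
    have hprod : ∀ {k : ℕ} {g : Fin k → E → ℝ≥0∞}, (∀ i, Measurable (g i)) →
        Measurable fun x : Fin k → E => ∏ i, g i (x i) := fun hg =>
      Finset.measurable_fun_prod _ fun i _ => (hg i).comp (measurable_pi_apply i)
    have hmp := (measurePreserving_piFinSuccAbove (fun _ : Fin (n + 1) => μ) 0).symm
    rw [← hmp.lintegral_comp (hprod hf), Fin.prod_univ_succ, ← ih _ fun i => hf i.succ,
      ← lintegral_prod_mul (hf 0).aemeasurable (hprod fun i => hf i.succ).aemeasurable]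
    refine lintegral_congr fun z => ?_
    rw [Fin.prod_univ_succ]
    rfl

theorem pi_withDensity {E : Type*} [MeasurableSpace E] (μ : Measure E) [SigmaFinite μ]
    (f : E → ℝ≥0) (hf : Measurable f) (n : ℕ) :
    Measure.pi (fun _ : Fin n => μ.withDensity fun x => (f x : ℝ≥0∞))
      = (Measure.pi fun _ : Fin n => μ).withDensity
          fun x => ((∏ i, f (x i) : ℝ≥0) : ℝ≥0∞) := by
  simp_rw [ENNReal.ofNNReal_finsetProd]
  refine Measure.pi_eq fun s hs => ?_
  rw [withDensity_apply _ (MeasurableSet.univ_pi hs),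
    ← lintegral_indicator (MeasurableSet.univ_pi hs)]
  simp_rw [withDensity_apply _ (hs _), ← lintegral_indicator (hs _)]
  rw [← lintegral_pi_prod μ (fun i => (s i).indicator fun x => (f x : ℝ≥0∞))
    fun i => (by fun_prop : Measurable fun x => (f x : ℝ≥0∞)).indicator (hs i)]
  refine lintegral_congr fun x => ?_
  by_cases hx : ∀ i, x i ∈ s i
  · rw [Set.indicator_of_mem (by simpa [Set.mem_pi] using hx)]
    exact Finset.prod_congr rfl fun i _ =>
      (Set.indicator_of_mem (hx i) fun x => (f x : ℝ≥0∞)).symm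
  · rw [Set.indicator_of_notMem (by simpa [Set.mem_pi] using hx)]
    push Not at hx
    obtain ⟨i, hi⟩ := hx
    exact (Finset.prod_eq_zero (Finset.mem_univ i) (Set.indicator_of_notMem hi _)).symm

theorem measurePreserving_comp_perm {E : Type*} [MeasurableSpace E] (μ : Measure E)
    [SigmaFinite μ] {n : ℕ} (ρ : Equiv.Perm (Fin n)) :
    MeasurePreserving (fun x : Fin n → E => x ∘ ρ) (Measure.pi fun _ => μ)
      (Measure.pi fun _ => μ) := by
  have hm : Measurable fun x : Fin n → E => x ∘ ρ :=
    measurable_pi_lambda _ fun i => measurable_pi_apply (ρ i)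
  refine ⟨hm, (Measure.pi_eq fun s hs => ?_).symm⟩
  rw [Measure.map_apply hm (MeasurableSet.univ_pi hs)]
  have : (fun x : Fin n → E => x ∘ ρ) ⁻¹' Set.univ.pi s = Set.univ.pi fun i => s (ρ.symm i) := by
    ext x
    simp only [Set.mem_preimage, Set.mem_univ_pi, Function.comp_apply]
    exact ⟨fun h i => by simpa using h (ρ.symm i), fun h i => by simpa using h (ρ i)⟩
  rw [this, Measure.pi_pi]
  exact Equiv.prod_comp ρ.symm fun i => μ (s i)

end MeasureTools

section DataModel

variable {𝒳 𝒴 𝒵 : Type*}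

/-- Permute the `X`-coordinates of a data vector, leaving `Y` and `Z` in place. -/
def permuteX {n : ℕ} (ρ : Equiv.Perm (Fin n)) (d : Fin n → 𝒵 × 𝒳 × 𝒴) : Fin n → 𝒵 × 𝒳 × 𝒴 :=
  fun i => ((d i).1, (d (ρ i)).2.1, (d i).2.2)

variable [MeasurableSpace 𝒳] [MeasurableSpace 𝒴] [MeasurableSpace 𝒵]

/-- The reordering `(x, (z, y)) ↦ (z, (x, y))`. -/
def rearrange : 𝒳 × 𝒵 × 𝒴 ≃ᵐ 𝒵 × 𝒳 × 𝒴 where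
  toFun p := (p.2.1, p.1, p.2.2)
  invFun p := (p.2.1, p.1, p.2.2)
  left_inv _ := rfl
  right_inv _ := rfl
  measurable_toFun := by dsimp; fun_prop
  measurable_invFun := by dsimp; fun_prop

theorem measurePreserving_permuteX (ν₀ : Measure 𝒳) [SigmaFinite ν₀] (η : Measure (𝒵 × 𝒴))
    [SigmaFinite η] {n : ℕ} (ρ : Equiv.Perm (Fin n)) :
    MeasurePreserving (permuteX (𝒳 := 𝒳) (𝒴 := 𝒴) (𝒵 := 𝒵) ρ)
      (Measure.pi fun _ => (ν₀.prod η).map rearrange)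
      (Measure.pi fun _ => (ν₀.prod η).map rearrange) := by
  have : SigmaFinite ((ν₀.prod η).map (rearrange (𝒳 := 𝒳) (𝒴 := 𝒴) (𝒵 := 𝒵))) :=
    rearrange.sigmaFinite_map
  have hr : MeasurePreserving (rearrange (𝒳 := 𝒳) (𝒴 := 𝒴) (𝒵 := 𝒵)) (ν₀.prod η)
      ((ν₀.prod η).map rearrange) := rearrange.measurable.measurePreserving _
  have hΦ := measurePreserving_pi (fun _ : Fin n => ν₀.prod η)
    (fun _ => (ν₀.prod η).map rearrange) fun _ => hr
  have hΨ := measurePreserving_pi (fun _ : Fin n => (ν₀.prod η).map rearrange)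
    (fun _ => ν₀.prod η) fun _ => hr.symm
  have hA := measurePreserving_arrowProdEquivProdArrow 𝒳 (𝒵 × 𝒴) (Fin n) (fun _ => ν₀)
    (fun _ => η)
  exact hΦ.comp <| hA.symm.comp <|
    ((measurePreserving_comp_perm ν₀ ρ).prod (MeasurePreserving.id _)).comp <| hA.comp hΨ

open ProbabilityTheory in
theorem bind_eq_withDensity (ν₀ : Measure 𝒳) [SigmaFinite ν₀]
    (μZ : Measure 𝒵) [SFinite μZ] (κ : Kernel 𝒵 𝒴) [IsMarkovKernel κ]
    (q : 𝒳 → 𝒵 → ℝ≥0) (hq : Measurable fun p : 𝒳 × 𝒵 => q p.1 p.2) :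
    (μZ.bind fun zv =>
      (((ν₀.withDensity fun x => (q x zv : ℝ≥0∞)).prod (κ zv)).map fun xy => (zv, xy.1, xy.2)))
      = ((ν₀.prod (μZ.compProd κ)).map rearrange).withDensity
          fun t => (q t.2.1 t.1 : ℝ≥0∞) := by
  have hqt : Measurable fun t : 𝒵 × 𝒳 × 𝒴 => (q t.2.1 t.1 : ℝ≥0∞) :=
    (hq.comp (by fun_prop : Measurable fun t : 𝒵 × 𝒳 × 𝒴 => (t.2.1, t.1))).coe_nnreal_ennreal
  have hker : Measurable fun zv =>
      (((ν₀.withDensity fun x => (q x zv : ℝ≥0∞)).prod (κ zv)).map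
        fun xy => (zv, xy.1, xy.2)) := by
    have hqu : Measurable (Function.uncurry fun (z : 𝒵) (x : 𝒳) => (q x z : ℝ≥0∞)) :=
      (hq.comp measurable_swap).coe_nnreal_ennreal
    let K : Kernel 𝒵 (𝒵 × 𝒳 × 𝒴) :=
      Kernel.id ×ₖ ((Kernel.const 𝒵 ν₀).withDensity (fun z x => (q x z : ℝ≥0∞)) ×ₖ κ)
    convert K.measurable using 2 with z
    simp only [K]
    rw [Kernel.prod_apply, Kernel.prod_apply, Kernel.withDensity_apply _ hqu, Kernel.const_apply,
      Kernel.id_apply, Measure.dirac_prod]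
  ext s hs
  rw [Measure.bind_apply hs hker.aemeasurable, withDensity_apply _ hs, ← lintegral_indicator hs,
    lintegral_map (hqt.indicator hs) rearrange.measurable,
    lintegral_prod_symm' (fun a => s.indicator _ (rearrange a)) ((hqt.indicator hs).comp rearrange.measurable),
    Measure.lintegral_compProd (f := fun w => ∫⁻ x, s.indicator _ (rearrange (x, w)) ∂ν₀)
      ((hqt.indicator hs).comp rearrange.measurable).lintegral_prod_left']
  refine lintegral_congr fun z => ?_
  have hz : Measurable fun xy : 𝒳 × 𝒴 => (z, xy.1, xy.2) := by fun_prop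
  rw [Measure.map_apply hz hs, Measure.prod_apply_symm (hz hs)]
  refine lintegral_congr fun y => ?_
  have hy : Measurable fun x : 𝒳 => (z, x, y) := by fun_prop
  rw [withDensity_apply _ ((hz hs).preimage (by fun_prop)),
    ← lintegral_indicator ((hz hs).preimage (by fun_prop))]
  rfl

end DataModel

theorem map_bind_sum_dirac {α V β : Type*} [MeasurableSpace α] [Fintype V] [MeasurableSpace V]
    [MeasurableSpace β] (μ : Measure α) (c : α → V → ℝ≥0∞)
    (hf : AEMeasurable (fun d => (∑ v, c d v • Measure.dirac v).map fun v => (d, v)) μ)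
    (g : α × V → β)
    (hg : AEMeasurable g (μ.bind fun d => (∑ v, c d v • Measure.dirac v).map fun v => (d, v)))
    {A : Set β} (hA : MeasurableSet A) :
    AEMeasurable (fun d => ∑ v, c d v * A.indicator 1 (g (d, v))) μ ∧
      ((μ.bind fun d => (∑ v, c d v • Measure.dirac v).map fun v => (d, v)).map g) A
        = ∫⁻ d, ∑ v, c d v * A.indicator 1 (g (d, v)) ∂μ := by
  set f : α → Measure (α × V) := fun d => (∑ v, c d v • Measure.dirac v).map fun v => (d, v)
    with hfdef
  have hfE : ∀ d, ∀ E : Set (α × V), MeasurableSet E →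
      f d E = ∑ v, c d v * E.indicator 1 (d, v) := fun d E hE => by
    have hd : Measurable fun v : V => (d, v) := by fun_prop
    rw [hfdef, Measure.map_apply hd hE, Measure.finsetSum_apply]
    refine Finset.sum_congr rfl fun v _ => ?_
    rw [Measure.smul_apply, Measure.dirac_apply' _ (hd hE), smul_eq_mul]
    rfl
  have hev : ∀ E : Set (α × V), MeasurableSet E → AEMeasurable (fun d => f d E) μ :=
    fun E hE => (Measure.measurable_coe hE).comp_aemeasurable hf
  have hE : MeasurableSet (hg.mk g ⁻¹' A) := hg.measurable_mk hA
  set N := toMeasurable (μ.bind f) {x | ¬ g x = hg.mk g x}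
  have hN : MeasurableSet N := measurableSet_toMeasurable _ _
  have hPN : ∫⁻ d, f d N ∂μ = 0 := by
    rw [← Measure.bind_apply hN hf, measure_toMeasurable]
    exact hg.ae_eq_mk
  have hae : (fun d => f d (hg.mk g ⁻¹' A)) =ᵐ[μ]
      fun d => ∑ v, c d v * A.indicator 1 (g (d, v)) := by
    filter_upwards [(lintegral_eq_zero_iff' (hev N hN)).1 hPN] with d hd
    rw [Pi.zero_apply, hfE d N hN, Finset.sum_eq_zero_iff] at hd
    rw [hfE d _ hE]
    refine Finset.sum_congr rfl fun v hv => ?_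
    rcases mul_eq_zero.1 (hd v hv) with h | h
    · simp [h]
    · have hnot : (d, v) ∉ N := by simpa using h
      have hgv : g (d, v) = hg.mk g (d, v) := by
        by_contra hne
        exact hnot (subset_toMeasurable _ _ hne)
      rw [hgv]
      rfl
  refine ⟨(hev _ hE).congr hae, ?_⟩
  rw [Measure.map_congr hg.ae_eq_mk, Measure.map_apply hg.measurable_mk hA,
    Measure.bind_apply hE hf]
  exact lintegral_congr_ae hae

theorem card_mul_lintegral_eq_lintegral_sum {α ι : Type*} [MeasurableSpace α] [Fintype ι]
    {μ : Measure α} {T : ι → α → α} (hT : ∀ i, MeasurePreserving (T i) μ μ) {H : α → ℝ≥0∞}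
    (hH : AEMeasurable H μ) :
    (Fintype.card ι : ℝ≥0∞) * ∫⁻ d, H d ∂μ = ∫⁻ d, ∑ i, H (T i d) ∂μ := by
  have hHT : ∀ i, AEMeasurable (fun d => H (T i d)) μ := fun i =>
    hH.comp_quasiMeasurePreserving (hT i).quasiMeasurePreserving
  rw [lintegral_finsetSum' _ fun i _ => hHT i]
  have : ∀ i, ∫⁻ d, H (T i d) ∂μ = ∫⁻ d, H d ∂μ := fun i => by
    have hH' : AEMeasurable H (μ.map (T i)) := by rwa [(hT i).map_eq]
    rw [← lintegral_map' hH' (hT i).measurable.aemeasurable, (hT i).map_eq]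
  simp [this]

section Combinatorics

theorem swapRel_symm {n : ℕ} {p π π' : Equiv.Perm (Fin n)} (hp : p * p = 1)
    (h : swapRel p π π') : swapRel p π' π := by
  obtain ⟨τ, hτ, rfl⟩ := h
  refine ⟨τ⁻¹, fun i => ?_, by simp⟩
  have hpp : ∀ j, p (p j) = j := fun j => by simpa using congrArg (· j) hp
  rcases hτ (τ⁻¹ i) with h | h
  · exact .inl (by simpa using h.symm)
  · refine .inr ?_
    rw [← hpp (τ⁻¹ i), ← h]
    simp

theorem swapRel_trans {n : ℕ} {p π π' π'' : Equiv.Perm (Fin n)} (hp : p * p = 1)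
    (h : swapRel p π π') (h' : swapRel p π' π'') : swapRel p π π'' := by
  obtain ⟨τ, hτ, rfl⟩ := h
  obtain ⟨τ', hτ', rfl⟩ := h'
  have hpp : ∀ j, p (p j) = j := fun j => by simpa using congrArg (· j) hp
  refine ⟨τ * τ', fun i => ?_, mul_assoc _ _ _⟩
  rw [Equiv.Perm.mul_apply]
  have h2 := hpp i
  rcases hτ' i with h | h <;> rcases hτ (τ' i) with h1 | h1 <;> rw [h1, h] <;> simp [h2]

theorem pairwiseKernel_reversible {n : ℕ} (w : Equiv.Perm (Fin n) → ℝ≥0∞)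
    (π π' : Equiv.Perm (Fin n)) :
    w π * pairwiseKernel w π π' = w π' * pairwiseKernel w π' π := by
  simp only [pairwiseKernel, ENNReal.div_eq_inv_mul, mul_left_comm (w _) (_⁻¹), Finset.mul_sum]
  refine Finset.sum_congr rfl fun p hp => ?_
  have hpp : p * p = 1 := (Finset.mem_filter.1 hp).2.1
  by_cases h : swapRel p π π'
  · have h' := swapRel_symm hpp h
    have hcls : (Finset.univ.filter fun π'' => swapRel p π π'')
        = Finset.univ.filter fun π'' => swapRel p π' π'' :=
      Finset.filter_congr fun _ _ => ⟨swapRel_trans hpp h', swapRel_trans hpp h⟩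
    rw [if_pos h, if_pos h', hcls]
    ring
  · rw [if_neg h, if_neg fun h' => h (swapRel_symm hpp h')]
    simp

theorem kernelPow_succ' {𝒮 : Type*} [Fintype 𝒮] [DecidableEq 𝒮] (K : 𝒮 → 𝒮 → ℝ≥0∞) (s : ℕ)
    (a b : 𝒮) : kernelPow K (s + 1) a b = ∑ c, kernelPow K s a c * K c b := by
  induction s generalizing a with
  | zero => simp [kernelPow]
  | succ s ih =>
    rw [kernelPow]
    simp_rw [ih, kernelPow, Finset.mul_sum, Finset.sum_mul]
    rw [Finset.sum_comm]
    simp_rw [mul_assoc]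

theorem kernelPow_reversible {𝒮 : Type*} [Fintype 𝒮] [DecidableEq 𝒮] {K : 𝒮 → 𝒮 → ℝ≥0∞}
    {w : 𝒮 → ℝ≥0∞} (hK : ∀ a b, w a * K a b = w b * K b a) (s : ℕ) (a b : 𝒮) :
    w a * kernelPow K s a b = w b * kernelPow K s b a := by
  induction s generalizing a with
  | zero =>
    by_cases h : a = b
    · rw [h]
    · simp [kernelPow, h, Ne.symm h]
  | succ s ih =>
    rw [kernelPow_succ' K s b a, kernelPow, Finset.mul_sum, Finset.mul_sum]
    refine Finset.sum_congr rfl fun c _ => ?_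
    rw [← mul_assoc, hK, mul_right_comm, ih, mul_assoc]

/-- Started from a reversible weight `w`, the state and the `M` chains run through the hub have
a joint weight that is symmetric in all `M + 1` of them. -/
theorem weight_mul_sum_kernelPow {𝒮 : Type*} [Fintype 𝒮] [DecidableEq 𝒮] {K : 𝒮 → 𝒮 → ℝ≥0∞}
    {w : 𝒮 → ℝ≥0∞} (hK : ∀ a b, w a * K a b = w b * K b a) (s M : ℕ) (a : 𝒮) (v : Fin M → 𝒮) :
    w a * ∑ c, kernelPow K s a c * ∏ m, kernelPow K s c (v m)
      = ∑ c, w c * ∏ m, kernelPow K s c ((Fin.cons a v : Fin (M + 1) → 𝒮) m) := by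
  rw [Finset.mul_sum]
  refine Finset.sum_congr rfl fun c _ => ?_
  rw [← mul_assoc, kernelPow_reversible hK, Fin.prod_univ_succ, mul_assoc]
  simp

variable {𝒳 𝒴 𝒵 : Type*} [LinearOrder 𝒳] {n : ℕ}

theorem sort_permuteX {d : Fin n → 𝒵 × 𝒳 × 𝒴} (hd : Function.Injective fun i => (d i).2.1)
    (ρ : Equiv.Perm (Fin n)) :
    ρ * Tuple.sort (fun i => (permuteX ρ d i).2.1) = Tuple.sort fun i => (d i).2.1 := by
  ext1 i
  exact hd (congrFun (Tuple.comp_perm_comp_sort_eq_comp_sort (f := fun i => (d i).2.1) (σ := ρ)) i)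

theorem Xord_permuteX (d : Fin n → 𝒵 × 𝒳 × 𝒴) (ρ : Equiv.Perm (Fin n)) :
    Xord (permuteX ρ d) = Xord d :=
  Tuple.comp_perm_comp_sort_eq_comp_sort (f := fun i => (d i).2.1) (σ := ρ)

theorem rankPerm_permuteX {d : Fin n → 𝒵 × 𝒳 × 𝒴}
    (hd : Function.Injective fun i => (d i).2.1) (ρ : Equiv.Perm (Fin n)) :
    rankPerm (permuteX ρ d) = rankPerm d * ρ := by
  rw [rankPerm, rankPerm, ← sort_permuteX hd ρ]
  group

theorem cptWeight_permuteX (q : 𝒳 → 𝒵 → ℝ≥0) (d : Fin n → 𝒵 × 𝒳 × 𝒴)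
    (ρ : Equiv.Perm (Fin n)) : cptWeight q (permuteX ρ d) = cptWeight q d := by
  ext π
  rw [cptWeight, Xord_permuteX]
  rfl

theorem Xord_rankPerm (d : Fin n → 𝒵 × 𝒳 × 𝒴) (i : Fin n) :
    Xord d (rankPerm d i) = (d i).2.1 := by
  simp [Xord, rankPerm]

theorem prod_density_eq_cptWeight (q : 𝒳 → 𝒵 → ℝ≥0) (d : Fin n → 𝒵 × 𝒳 × 𝒴) :
    ((∏ i, q (d i).2.1 (d i).1 : ℝ≥0) : ℝ≥0∞) = cptWeight q d (rankPerm d) := by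
  simp_rw [cptWeight, Xord_rankPerm, ENNReal.ofNNReal_finsetProd]

/-- The probability that `cptSamplerLaw` gives to a tuple of permutations. -/
noncomputable def samplerProb (q : 𝒳 → 𝒵 → ℝ≥0) (S M : ℕ) (d : Fin n → 𝒵 × 𝒳 × 𝒴)
    (v : Fin M → Equiv.Perm (Fin n)) : ℝ≥0∞ :=
  ∑ c : Equiv.Perm (Fin n),
    kernelPow (pairwiseKernel (cptWeight q d)) S (rankPerm d) c
      * ∏ m : Fin M, kernelPow (pairwiseKernel (cptWeight q d)) S c (v m)

/-- The `M + 1` triples `(X,Y,Z), (X⁽¹⁾,Y,Z), …, (X⁽ᴹ⁾,Y,Z)`, reordered by `σ`. -/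
noncomputable def cptTriples (M : ℕ) (σ : Equiv.Perm (Fin (M + 1)))
    (ω : (Fin n → 𝒵 × 𝒳 × 𝒴) × (Fin M → Equiv.Perm (Fin n))) (m : Fin (M + 1)) :
    (Fin n → 𝒳) × (Fin n → 𝒴) × (Fin n → 𝒵) :=
  (fun i => Xord ω.1
      ((Fin.cons (rankPerm ω.1) ω.2 : Fin (M + 1) → Equiv.Perm (Fin n)) (σ m) i),
    fun i => (ω.1 i).2.2, fun i => (ω.1 i).1)

theorem sum_permuteX_eq (q : 𝒳 → 𝒵 → ℝ≥0) (S M : ℕ) {d : Fin n → 𝒵 × 𝒳 × 𝒴}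
    (hd : Function.Injective fun i => (d i).2.1) (σ : Equiv.Perm (Fin (M + 1)))
    (φ : (Fin (M + 1) → (Fin n → 𝒳) × (Fin n → 𝒴) × (Fin n → 𝒵)) → ℝ≥0∞) :
    ∑ ρ : Equiv.Perm (Fin n),
      cptWeight q (permuteX ρ d) (rankPerm (permuteX ρ d)) *
        ∑ v, samplerProb q S M (permuteX ρ d) v * φ (cptTriples M σ (permuteX ρ d, v))
      = ∑ u : Fin (M + 1) → Equiv.Perm (Fin n),
          (∑ c, cptWeight q d c *
            ∏ m, kernelPow (pairwiseKernel (cptWeight q d)) S c (u m)) *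
          φ fun m => (fun i => Xord d (u m i), fun i => (d i).2.2, fun i => (d i).1) := by
  set J : (Fin (M + 1) → Equiv.Perm (Fin n)) → ℝ≥0∞ := fun u =>
    ∑ c, cptWeight q d c * ∏ m, kernelPow (pairwiseKernel (cptWeight q d)) S c (u m)
  set ψ : (Fin (M + 1) → Equiv.Perm (Fin n)) → ℝ≥0∞ := fun u =>
    φ fun m => (fun i => Xord d (u m i), fun i => (d i).2.2, fun i => (d i).1)
  have hterm : ∀ ρ : Equiv.Perm (Fin n),
      cptWeight q (permuteX ρ d) (rankPerm (permuteX ρ d)) *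
        ∑ v, samplerProb q S M (permuteX ρ d) v * φ (cptTriples M σ (permuteX ρ d, v))
      = ∑ v : Fin M → Equiv.Perm (Fin n),
          J (Fin.cons (rankPerm d * ρ) v) *
            ψ ((Fin.cons (rankPerm d * ρ) v : Fin (M + 1) → Equiv.Perm (Fin n)) ∘ σ) := by
    intro ρ
    rw [Finset.mul_sum]
    refine Finset.sum_congr rfl fun v _ => ?_
    rw [samplerProb, ← mul_assoc, cptWeight_permuteX, rankPerm_permuteX hd,
      weight_mul_sum_kernelPow (pairwiseKernel_reversible (cptWeight q d))]
    congr 2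
    ext1 m
    rw [cptTriples, Xord_permuteX, rankPerm_permuteX hd]
    rfl
  simp_rw [hterm]
  refine (Equiv.sum_comp (Equiv.mulLeft (rankPerm d)) fun π => ∑ v : Fin M → Equiv.Perm (Fin n),
    J (Fin.cons π v) * ψ ((Fin.cons π v : Fin (M + 1) → Equiv.Perm (Fin n)) ∘ σ)).trans ?_
  rw [← Fintype.sum_prod_type' fun (π : Equiv.Perm (Fin n)) (v : Fin M → Equiv.Perm (Fin n)) =>
    J (Fin.cons π v) * ψ ((Fin.cons π v : Fin (M + 1) → Equiv.Perm (Fin n)) ∘ σ)]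
  refine (Equiv.sum_comp (Fin.consEquiv fun _ => Equiv.Perm (Fin n))
    fun u => J u * ψ (u ∘ σ)).trans ?_
  rw [← Equiv.sum_comp (σ.arrowCongr (Equiv.refl (Equiv.Perm (Fin n)))) fun u => J u * ψ (u ∘ σ)]
  refine Finset.sum_congr rfl fun u _ => ?_
  congr 1
  · refine Finset.sum_congr rfl fun c _ => ?_
    congr 1
    exact Equiv.prod_comp σ.symm fun m =>
      kernelPow (pairwiseKernel (cptWeight q d)) S c (u m)
  · congr 1
    ext1 m
    simp

end Combinatorics

/-- **Exchangeability of the CPT copies produced by the exchangeable MCMC sampler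
(Theorem 2 / Algorithm 2).** Data model (encoding `H₀ : X ⊥ Y | Z` with conditional density
`q(·|z) > 0` of `X` given `Z = z` w.r.t. `ν₀`): each data point is drawn as `Z ~ μZ` and
then, conditionally independently given `Z`, `X ~ ν₀.withDensity q(·|Z)` and `Y ~ κY Z`; the
`n ≥ 2` points are i.i.d., and the `X` values are a.s. pairwise distinct. Conditionally on
the data, `(Π⁽¹⁾,…,Π⁽ᴹ⁾)` are produced by Algorithm 2 (run `S ≥ 1` steps of the pairwise
sampler from the true ranks `Π` to get `Π♯`, then `M` independent `S`-step runs from `Π♯`),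
and `X⁽ᵐ⁾ = X_{(Π⁽ᵐ⁾)}`. Then the `M+1` triples `(X,Y,Z), (X⁽¹⁾,Y,Z), …, (X⁽ᴹ⁾,Y,Z)` are
exchangeable. -/
theorem cpt_sampler_exchangeable {𝒳 𝒴 𝒵 : Type*}
    [MeasurableSpace 𝒳] [LinearOrder 𝒳] [MeasurableSpace 𝒴] [MeasurableSpace 𝒵]
    (ν₀ : Measure 𝒳) [SigmaFinite ν₀]
    (μZ : Measure 𝒵) [IsProbabilityMeasure μZ]
    (κY : 𝒵 → Measure 𝒴) (hκYprob : ∀ zv, IsProbabilityMeasure (κY zv))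
    (hκYmeas : Measurable κY)
    (q : 𝒳 → 𝒵 → ℝ≥0) (hqmeas : Measurable fun p : 𝒳 × 𝒵 => q p.1 p.2)
    (hqpos : ∀ x zv, 0 < q x zv) (hq1 : ∀ zv, ∫⁻ x, (q x zv : ℝ≥0∞) ∂ν₀ = 1)
    (n : ℕ) (hn : 2 ≤ n) (S M : ℕ) (hS : 1 ≤ S)
    (singleLaw : Measure (𝒵 × 𝒳 × 𝒴))
    (hsingle : singleLaw = μZ.bind fun zv =>
      (((ν₀.withDensity fun x => (q x zv : ℝ≥0∞)).prod (κY zv)).map fun xy => (zv, xy.1, xy.2)))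
    (dataLaw : Measure (Fin n → 𝒵 × 𝒳 × 𝒴))
    (hdata : dataLaw = Measure.pi fun _ : Fin n => singleLaw)
    (hdistinct : ∀ᵐ d ∂dataLaw, Function.Injective fun i => (d i).2.1)
    (P : Measure ((Fin n → 𝒵 × 𝒳 × 𝒴) × (Fin M → Equiv.Perm (Fin n))))
    (hP : P = dataLaw.bind fun d => (cptSamplerLaw q S M d).map fun v => (d, v)) :
    ∀ σ : Equiv.Perm (Fin (M + 1)),
      P.map (fun ω => fun m : Fin (M + 1) =>
          ((fun i => Xord ω.1
              ((Fin.cons (rankPerm ω.1) ω.2 : Fin (M + 1) → Equiv.Perm (Fin n)) (σ m) i),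
            fun i => (ω.1 i).2.2, fun i => (ω.1 i).1) :
            (Fin n → 𝒳) × (Fin n → 𝒴) × (Fin n → 𝒵)))
        = P.map (fun ω => fun m : Fin (M + 1) =>
          ((fun i => Xord ω.1
              ((Fin.cons (rankPerm ω.1) ω.2 : Fin (M + 1) → Equiv.Perm (Fin n)) m i),
            fun i => (ω.1 i).2.2, fun i => (ω.1 i).1) :
            (Fin n → 𝒳) × (Fin n → 𝒴) × (Fin n → 𝒵))) := by
  intro σ
  let κ : ProbabilityTheory.Kernel 𝒵 𝒴 := ⟨κY, hκYmeas⟩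
  have : ProbabilityTheory.IsMarkovKernel κ := ⟨hκYprob⟩
  set base : Measure (𝒵 × 𝒳 × 𝒴) := (ν₀.prod (μZ.compProd κ)).map rearrange
  have : SigmaFinite base := rearrange.sigmaFinite_map
  have hqt : Measurable fun t : 𝒵 × 𝒳 × 𝒴 => q t.2.1 t.1 :=
    hqmeas.comp (by fun_prop : Measurable fun t : 𝒵 × 𝒳 × 𝒴 => (t.2.1, t.1))
  set W : (Fin n → 𝒵 × 𝒳 × 𝒴) → ℝ≥0 := fun d => ∏ i, q (d i).2.1 (d i).1 with hWdef
  have hW : Measurable W :=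
    Finset.measurable_fun_prod _ fun i _ => hqt.comp (measurable_pi_apply i)
  set B : Measure (Fin n → 𝒵 × 𝒳 × 𝒴) := Measure.pi fun _ => base
  have hdens : dataLaw = B.withDensity fun d => (W d : ℝ≥0∞) := by
    have hsl : singleLaw = base.withDensity fun t => (q t.2.1 t.1 : ℝ≥0∞) :=
      hsingle.trans (bind_eq_withDensity ν₀ μZ κ q hqmeas)
    rw [hdata, hsl, pi_withDensity base (fun t => q t.2.1 t.1) hqt]
  have hinj : ∀ᵐ d ∂B, Function.Injective fun i => (d i).2.1 := by
    rw [hdens, ae_withDensity_iff hW.coe_nnreal_ennreal] at hdistinct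
    filter_upwards [hdistinct] with d hd
    exact hd (ENNReal.coe_ne_zero.2 (Finset.prod_pos fun i _ => hqpos _ _).ne')
  have hT : ∀ ρ : Equiv.Perm (Fin n), MeasurePreserving (permuteX ρ) B B := fun ρ =>
    measurePreserving_permuteX ν₀ (μZ.compProd κ) ρ
  by_cases hf : AEMeasurable (fun d => (cptSamplerLaw q S M d).map fun v => (d, v)) dataLaw
  swap
  · have hP0 : P = 0 := by
      rw [hP, Measure.bind, Measure.map_of_not_aemeasurable hf, Measure.join_zero]
    simp [hP0]
  change P.map (cptTriples M σ) = P.map (cptTriples M 1)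
  have hreorder : ∀ τ τ' : Equiv.Perm (Fin (M + 1)), AEMeasurable (cptTriples M τ) P →
      AEMeasurable (cptTriples M τ') P := by
    intro τ τ' h
    have hm : Measurable fun (g : Fin (M + 1) → (Fin n → 𝒳) × (Fin n → 𝒴) × (Fin n → 𝒵)) m =>
        g ((τ⁻¹ * τ') m) := measurable_pi_lambda _ fun m => measurable_pi_apply _
    convert hm.comp_aemeasurable h using 1
    ext1 ω
    ext1 m
    simp [cptTriples]
  by_cases hg : AEMeasurable (cptTriples M 1) P
  swap
  · rw [Measure.map_of_not_aemeasurable hg,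
      Measure.map_of_not_aemeasurable fun h => hg (hreorder σ 1 h)]
  have hsym : ∀ τ : Equiv.Perm (Fin (M + 1)), ∀ A, MeasurableSet A →
      (Fintype.card (Equiv.Perm (Fin n)) : ℝ≥0∞) * P.map (cptTriples M τ) A
        = ∫⁻ d, ∑ u : Fin (M + 1) → Equiv.Perm (Fin n),
          (∑ c, cptWeight q d c *
            ∏ m, kernelPow (pairwiseKernel (cptWeight q d)) S c (u m)) *
          A.indicator 1 fun m =>
            (fun i => Xord d (u m i), fun i => (d i).2.2, fun i => (d i).1) ∂B := by
    intro τ A hA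
    have hgτ := hreorder 1 τ hg
    rw [hP] at hgτ ⊢
    obtain ⟨hFm, hF⟩ := map_bind_sum_dirac dataLaw (samplerProb q S M) hf (cptTriples M τ) hgτ hA
    refine (congrArg _ hF).trans ?_
    rw [hdens] at hFm ⊢
    rw [lintegral_withDensity_eq_lintegral_mul₀' hW.coe_nnreal_ennreal.aemeasurable hFm]
    refine (card_mul_lintegral_eq_lintegral_sum hT
      ((aemeasurable_withDensity_ennreal_iff hW).1 hFm)).trans (lintegral_congr_ae ?_)
    filter_upwards [hinj] with d hd
    rw [← sum_permuteX_eq q S M hd τ (A.indicator 1)]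
    refine Finset.sum_congr rfl fun ρ _ => ?_
    rw [hWdef, prod_density_eq_cptWeight]
  ext A hA
  have hcard : (Fintype.card (Equiv.Perm (Fin n)) : ℝ≥0∞) ≠ 0 :=
    Nat.cast_ne_zero.2 Fintype.card_ne_zero
  exact (ENNReal.mul_right_inj hcard (ENNReal.natCast_ne_top _)).1
    ((hsym σ A hA).trans (hsym 1 A hA).symm)
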